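/- arXiv:1807.05410 — 2 statements merged into one kernel-verified Lean document; each statement's English description precedes it below -/
import Mathlib

section
/- For every measurable estimator T : E → {0,…,N} and every λ ≥ 0, applying the convex non-decreasing non-negative map u ↦ u^{1+λ}: ((1/(N+1)) ∑_{j=0}^{N} P_j(T = j))^{1+λ} ≤ (1/(N+1))^{1+λ} ∑_{j=0}^{N} ∫_E p_j^{1+λ} q^{−λ} dμ, for any probability Q = q·μ with q > 0 μ-a.e.; in particular the supremum B̄ over estimators of the average success probability satisfies ((N+1) B̄)^{1+λ} ≤ ∑_{j=0}^{N} ∫_E p_j^{1+λ} q^{−λ} dμ. -/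
open MeasureTheory

/-- Bernoulli's inequality in homogeneous form: the perspective `f ^ (1 + l) * q ^ (-l)` of the power
function lies above its tangent plane along the ray `f = a * q`. -/
theorem tangent_le_rpow_mul_rpow_neg {a q f l : ℝ} (ha : 0 < a) (hq : 0 < q) (hf : 0 ≤ f)
    (hl : 0 ≤ l) :
    a ^ (1 + l) * q + (1 + l) * a ^ l * (f - a * q) ≤ f ^ (1 + l) * q ^ (-l) := by
  have haq : 0 < a * q := mul_pos ha hq
  have hbern : 1 + (1 + l) * (f / (a * q) - 1) ≤ (1 + (f / (a * q) - 1)) ^ (1 + l) :=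
    one_add_mul_self_le_rpow_one_add (by linarith [div_nonneg hf haq.le]) (by linarith)
  rw [add_sub_cancel, Real.div_rpow hf haq.le, Real.mul_rpow ha.le hq.le] at hbern
  have hmul := mul_le_mul_of_nonneg_left hbern
    (mul_nonneg (Real.rpow_nonneg ha.le (1 + l)) hq.le)
  have hal : 0 < a ^ l := Real.rpow_pos_of_pos ha l
  have hql : 0 < q ^ l := Real.rpow_pos_of_pos hq l
  rw [Real.rpow_one_add' ha.le (by linarith), Real.rpow_one_add' hq.le (by linarith)] at hmul
  rw [Real.rpow_one_add' ha.le (by linarith), Real.rpow_neg hq.le]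
  refine le_of_eq_of_le ?_ (hmul.trans_eq ?_) <;> field_simp

/-- Jensen's inequality for `u ↦ u ^ (1 + l)` and the probability density `q`, applied to `f / q`. -/
theorem integral_rpow_one_add_le {E : Type*} [MeasurableSpace E] {μ : Measure E} {f q g : E → ℝ}
    {l : ℝ} (hl : 0 ≤ l) (hf : Integrable f μ) (hf_nonneg : ∀ x, 0 ≤ f x)
    (hq : Integrable q μ) (hq_prob : ∫ x, q x ∂μ = 1) (hq_pos : ∀ᵐ x ∂μ, 0 < q x)
    (hg : Integrable g μ) (hfg : ∀ x, f x ^ (1 + l) * q x ^ (-l) ≤ g x) :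
    (∫ x, f x ∂μ) ^ (1 + l) ≤ ∫ x, g x ∂μ := by
  rcases (integral_nonneg hf_nonneg : 0 ≤ ∫ x, f x ∂μ).eq_or_lt with h0 | hpos
  · rw [← h0, Real.zero_rpow (by linarith)]
    refine integral_nonneg_of_ae ?_
    filter_upwards [hq_pos] with x hx
    exact (mul_nonneg (Real.rpow_nonneg (hf_nonneg x) _) (Real.rpow_nonneg hx.le _)).trans (hfg x)
  · set a := ∫ x, f x ∂μ with ha
    have hlin : Integrable (fun x => f x - a * q x) μ := hf.sub (hq.const_mul a)
    calc a ^ (1 + l)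
        = ∫ x, a ^ (1 + l) * q x + (1 + l) * a ^ l * (f x - a * q x) ∂μ := by
          rw [integral_add (hq.const_mul _) (hlin.const_mul _), integral_const_mul,
            integral_const_mul, integral_sub hf (hq.const_mul a), integral_const_mul, hq_prob, ← ha]
          ring
      _ ≤ ∫ x, g x ∂μ := by
          refine integral_mono_ae ((hq.const_mul _).add (hlin.const_mul _)) hg ?_
          filter_upwards [hq_pos] with x hx
          exact (tangent_le_rpow_mul_rpow_neg hpos hx (hf_nonneg x) hl).trans (hfg x)

/-- For every measurable estimator `T : E → {0,…,N}` and every `λ ≥ 0`,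
`((1/(N+1)) ∑_j P_j(T = j))^{1+λ} ≤ (1/(N+1))^{1+λ} ∑_j ∫ p_j^{1+λ} q^{−λ} dμ`
for any probability `Q = q·μ` with `q > 0` `μ`-a.e.; in particular the supremum `B̄` over
estimators of the average success probability satisfies
`((N+1) B̄)^{1+λ} ≤ ∑_j ∫ p_j^{1+λ} q^{−λ} dμ`. -/
theorem average_success_rpow_le
    {E : Type*} [MeasurableSpace E] (μ : Measure E) (N : ℕ) (hN : 1 ≤ N)
    (p : Fin (N + 1) → E → ℝ)
    (hp_meas : ∀ j, Measurable (p j))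
    (hp_nonneg : ∀ j x, 0 ≤ p j x)
    (hp_int : ∀ j, Integrable (p j) μ)
    (hp_prob : ∀ j, ∫ x, p j x ∂μ = 1)
    (q : E → ℝ)
    (hq_meas : Measurable q)
    (hq_nonneg : ∀ x, 0 ≤ q x)
    (hq_int : Integrable q μ)
    (hq_prob : ∫ x, q x ∂μ = 1)
    (hq_pos : ∀ᵐ x ∂μ, 0 < q x)
    (lam : ℝ) (hlam : 0 ≤ lam)
    (h_int : ∀ j, Integrable (fun x => p j x ^ (1 + lam) * q x ^ (-lam)) μ) :
    (∀ T : E → Fin (N + 1), Measurable T →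
        (((N : ℝ) + 1)⁻¹ * ∑ j, ∫ x in {x | T x = j}, p j x ∂μ) ^ (1 + lam) ≤
          (((N : ℝ) + 1)⁻¹) ^ (1 + lam) *
            ∑ j, ∫ x, p j x ^ (1 + lam) * q x ^ (-lam) ∂μ) ∧
      ((((N : ℝ) + 1) *
            ⨆ S : {S : E → Fin (N + 1) // Measurable S},
              ((N : ℝ) + 1)⁻¹ * ∑ j, ∫ x in {x | S.1 x = j}, p j x ∂μ) ^ (1 + lam) ≤
        ∑ j, ∫ x, p j x ^ (1 + lam) * q x ^ (-lam) ∂μ) := by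
  have hsum : ∀ T : E → Fin (N + 1), Measurable T →
      (∑ j, ∫ x in {x | T x = j}, p j x ∂μ) ^ (1 + lam) ≤
        ∑ j, ∫ x, p j x ^ (1 + lam) * q x ^ (-lam) ∂μ := by
    intro T hT
    have hset : ∀ j, MeasurableSet {x | T x = j} := fun j => hT (measurableSet_singleton j)
    have hind : ∀ j, Integrable ({x | T x = j}.indicator (p j)) μ :=
      fun j => (hp_int j).indicator (hset j)
    have heq : (fun x => ∑ j, {x | T x = j}.indicator (p j) x) = fun x => p (T x) x := by
      funext x
      simp [Set.indicator_apply]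
    have hint : Integrable (fun x => p (T x) x) μ :=
      heq ▸ integrable_finsetSum _ fun j _ => hind j
    have hval : ∑ j, ∫ x in {x | T x = j}, p j x ∂μ = ∫ x, p (T x) x ∂μ := by
      rw [← heq, integral_finsetSum _ fun j _ => hind j]
      exact Finset.sum_congr rfl fun j _ => (integral_indicator (hset j)).symm
    rw [hval, ← integral_finsetSum _ fun j _ => h_int j]
    refine integral_rpow_one_add_le hlam hint (fun x => hp_nonneg _ x) hq_int hq_prob hq_pos
      (integrable_finsetSum _ fun j _ => h_int j) fun x => ?_
    exact Finset.single_le_sum (f := fun j => p j x ^ (1 + lam) * q x ^ (-lam))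
      (fun j _ => mul_nonneg (Real.rpow_nonneg (hp_nonneg j x) _)
        (Real.rpow_nonneg (hq_nonneg x) _)) (Finset.mem_univ (T x))
  have hnonneg : ∀ T : E → Fin (N + 1), 0 ≤ ∑ j, ∫ x in {x | T x = j}, p j x ∂μ :=
    fun T => Finset.sum_nonneg fun j _ => integral_nonneg (hp_nonneg j)
  have hN_pos : (0 : ℝ) < N + 1 := by positivity
  have hr : 0 < 1 + lam := by linarith
  refine ⟨fun T hT => ?_, ?_⟩
  · rw [Real.mul_rpow (inv_nonneg.2 hN_pos.le) (hnonneg T)]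
    exact mul_le_mul_of_nonneg_left (hsum T hT) (Real.rpow_nonneg (inv_nonneg.2 hN_pos.le) _)
  · have : Nonempty {S : E → Fin (N + 1) // Measurable S} := ⟨⟨fun _ => 0, measurable_const⟩⟩
    have hR : 0 ≤ ∑ j, ∫ x, p j x ^ (1 + lam) * q x ^ (-lam) ∂μ :=
      (Real.rpow_nonneg (hnonneg _) _).trans (hsum (fun _ => 0) measurable_const)
    have hsup : ∀ F : {S : E → Fin (N + 1) // Measurable S} → ℝ, (∀ S, 0 ≤ F S) →
        (∀ S, F S ^ (1 + lam) ≤ ∑ j, ∫ x, p j x ^ (1 + lam) * q x ^ (-lam) ∂μ) →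
        (((N : ℝ) + 1) * ⨆ S, ((N : ℝ) + 1)⁻¹ * F S) ^ (1 + lam) ≤
          ∑ j, ∫ x, p j x ^ (1 + lam) * q x ^ (-lam) ∂μ := by
      intro F hF hFle
      rw [← Real.mul_iSup_of_nonneg (inv_nonneg.2 hN_pos.le), mul_inv_cancel_left₀ hN_pos.ne',
        ← Real.le_rpow_inv_iff_of_pos (Real.iSup_nonneg hF) hR hr]
      exact ciSup_le fun S => (Real.le_rpow_inv_iff_of_pos (hF S) hR hr).2 (hFle S)
    exact hsup _ (fun S => hnonneg S.1) fun S => hsum S.1 S.2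
end

section
/- For any measurable estimator T : E → {0,…,N}, min_{0≤j≤N} P_j(T = j) ≤ (1/(N+1)) ∫_E max_{0≤j≤N} p_j(x) dμ(x); hence the minimax probability of error satisfies inf_T max_{0≤j≤N} P_j(T ≠ j) ≥ 1 − (1/(N+1)) ∫_E max_{0≤j≤N} p_j dμ. -/
open MeasureTheory

theorem integrable_iSup_of_nonneg {ι E : Type*} [Fintype ι] [MeasurableSpace E] {μ : Measure E}
    {p : ι → E → ℝ} (hp_meas : ∀ j, Measurable (p j)) (hp_nonneg : ∀ j x, 0 ≤ p j x)
    (hp_int : ∀ j, Integrable (p j) μ) : Integrable (fun x => ⨆ j, p j x) μ := by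
  refine (integrable_finsetSum Finset.univ fun j _ => hp_int j).mono'
    (Measurable.iSup hp_meas).aestronglyMeasurable (Filter.Eventually.of_forall fun x => ?_)
  rw [Real.norm_of_nonneg (Real.iSup_nonneg fun j => hp_nonneg j x)]
  exact Real.iSup_le
    (fun j => Finset.single_le_sum (fun i _ => hp_nonneg i x) (Finset.mem_univ j))
    (Finset.sum_nonneg fun i _ => hp_nonneg i x)

/-- The total success mass of an estimator is at most the integral of the maximal density. -/
theorem sum_setIntegral_fiber_le_integral_iSup {ι E : Type*} [Fintype ι] [MeasurableSpace ι]
    [MeasurableSingletonClass ι] [MeasurableSpace E] {μ : Measure E}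
    {p : ι → E → ℝ} (hp_meas : ∀ j, Measurable (p j)) (hp_nonneg : ∀ j x, 0 ≤ p j x)
    (hp_int : ∀ j, Integrable (p j) μ) {T : E → ι} (hT : Measurable T) :
    ∑ j, ∫ x in {x | T x = j}, p j x ∂μ ≤ ∫ x, ⨆ j, p j x ∂μ := by
  classical
  have hfiber (j : ι) : MeasurableSet {x | T x = j} := hT (measurableSet_singleton j)
  have hint (j : ι) : Integrable ({x | T x = j}.indicator (p j)) μ :=
    (hp_int j).indicator (hfiber j)
  simp_rw [← integral_indicator (hfiber _)]
  rw [← integral_finsetSum _ fun j _ => hint j]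
  refine integral_mono (integrable_finsetSum _ fun j _ => hint j)
    (integrable_iSup_of_nonneg hp_meas hp_nonneg hp_int) fun x => ?_
  simpa [Set.indicator_apply] using le_ciSup (Set.finite_range fun j => p j x).bddAbove (T x)

theorem iInf_le_inv_mul_sum (N : ℕ) (a : Fin (N + 1) → ℝ) :
    (⨅ j, a j) ≤ ((N : ℝ) + 1)⁻¹ * ∑ j, a j := by
  rw [le_inv_mul_iff₀ (by positivity)]
  simpa using Finset.card_nsmul_le_sum Finset.univ a (⨅ j, a j)
    fun j _ => ciInf_le (Set.finite_range a).bddBelow j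

/-- For any measurable estimator `T : E → {0,…,N}`,
`min_j P_j(T = j) ≤ (1/(N+1)) ∫ max_j p_j dμ`; hence the minimax probability of error
satisfies `inf_T max_j P_j(T ≠ j) ≥ 1 − (1/(N+1)) ∫ max_j p_j dμ`. -/
theorem minimax_error_lower_bound
    {E : Type*} [MeasurableSpace E] (μ : Measure E) (N : ℕ) (hN : 1 ≤ N)
    (p : Fin (N + 1) → E → ℝ)
    (hp_meas : ∀ j, Measurable (p j))
    (hp_nonneg : ∀ j x, 0 ≤ p j x)
    (hp_int : ∀ j, Integrable (p j) μ)
    (hp_prob : ∀ j, ∫ x, p j x ∂μ = 1) :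
    (∀ T : E → Fin (N + 1), Measurable T →
        (⨅ j, ∫ x in {x | T x = j}, p j x ∂μ) ≤
          ((N : ℝ) + 1)⁻¹ * ∫ x, ⨆ j, p j x ∂μ) ∧
      1 - ((N : ℝ) + 1)⁻¹ * (∫ x, ⨆ j, p j x ∂μ) ≤
        ⨅ S : {S : E → Fin (N + 1) // Measurable S},
          ⨆ j, (1 - ∫ x in {x | S.1 x = j}, p j x ∂μ) := by
  have hsuccess (T : E → Fin (N + 1)) (hT : Measurable T) :
      (⨅ j, ∫ x in {x | T x = j}, p j x ∂μ) ≤ ((N : ℝ) + 1)⁻¹ * ∫ x, ⨆ j, p j x ∂μ :=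
    (iInf_le_inv_mul_sum N _).trans <| mul_le_mul_of_nonneg_left
      (sum_setIntegral_fiber_le_integral_iSup hp_meas hp_nonneg hp_int hT) (by positivity)
  refine ⟨hsuccess, ?_⟩
  have : Nonempty {S : E → Fin (N + 1) // Measurable S} := ⟨⟨fun _ => 0, measurable_const⟩⟩
  refine le_ciInf fun S => ?_
  obtain ⟨j, hj⟩ := exists_eq_ciInf_of_finite (f := fun j => ∫ x in {x | S.1 x = j}, p j x ∂μ)
  have hS := hsuccess S.1 S.2
  rw [← hj] at hS
  exact (sub_le_sub_left hS 1).trans (le_ciSup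
    (f := fun j => 1 - ∫ x in {x | S.1 x = j}, p j x ∂μ) (Set.finite_range _).bddAbove j)
end
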